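/- Let d ∈ (0,n], β ∈ [1,∞), and let ω be a nonnegative measurable function on ℝⁿ×(0,∞). Define ω_β(x,t) := sup_{y ∈ B(x,βt)} ω(y,t). Then ∫_{ℝⁿ} N(ω_β)(x) dH^d(x) ≤ C β^d ∫_{ℝⁿ} Nω(x) dH^d(x), where the integrals are Choquet integrals and C is a positive constant depending only on n. -/

import Mathlib

open MeasureTheory Metric Set
open scoped ENNReal NNReal

noncomputable section

/-- The `d`-dimensional Hausdorff capacity of `E ⊆ ℝⁿ`. -/
def Hcap (n : ℕ) (d : ℝ) (E : Set (EuclideanSpace ℝ (Fin n))) : ℝ≥0∞ :=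
  ⨅ (c : ℕ → EuclideanSpace ℝ (Fin n) × ℝ≥0) (_ : E ⊆ ⋃ j, ball (c j).1 (c j).2),
    ∑' j, ((c j).2 : ℝ≥0∞) ^ d

/-- The nontangential maximal function of `ω : ℝⁿ × (0,∞) → [0,∞]`. -/
def ntMax (n : ℕ) (ω : EuclideanSpace ℝ (Fin n) → ℝ → ℝ≥0∞)
    (x : EuclideanSpace ℝ (Fin n)) : ℝ≥0∞ :=
  ⨆ (y : EuclideanSpace ℝ (Fin n)) (t : ℝ) (_ : 0 < t) (_ : dist y x < t), ω y t

/-- The Choquet integral of `f` against the `d`-dimensional Hausdorff capacity. -/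
def choquet (n : ℕ) (d : ℝ) (f : EuclideanSpace ℝ (Fin n) → ℝ≥0∞) : ℝ≥0∞ :=
  ∫⁻ lam in Ioi (0:ℝ), Hcap n d {x | ENNReal.ofReal lam < f x}


/-- `ω_β(x,t) = sup_{y ∈ B(x,βt)} ω(y,t)`. -/
def apDilate (n : ℕ) (β : ℝ) (ω : EuclideanSpace ℝ (Fin n) → ℝ → ℝ≥0∞) :
    EuclideanSpace ℝ (Fin n) → ℝ → ℝ≥0∞ :=
  fun x t => ⨆ (y : EuclideanSpace ℝ (Fin n)) (_ : dist y x < β * t), ω y t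

lemma Hcap_le_of_countable {n : ℕ} {d : ℝ} (hd : 0 < d) {ι : Type*} [Countable ι]
    {E : Set (EuclideanSpace ℝ (Fin n))} (c : ι → EuclideanSpace ℝ (Fin n) × ℝ≥0)
    (hc : E ⊆ ⋃ j, ball (c j).1 (c j).2) :
    Hcap n d E ≤ ∑' j, ((c j).2 : ℝ≥0∞) ^ d := by
  obtain ⟨e, he⟩ := exists_injective_nat ι
  have hext : ∀ i, Function.extend e c (fun _ => (0, 0)) (e i) = c i := fun i => he.extend_apply _ _ _
  refine (iInf₂_le (Function.extend e c (fun _ => (0, 0))) ?_).trans ?_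
  · intro x hx
    obtain ⟨i, hi⟩ := mem_iUnion.1 (hc hx)
    refine mem_iUnion.2 ⟨e i, ?_⟩
    rw [hext]; exact hi
  · rw [← he.tsum_eq]
    · simp only [hext]; exact le_rfl
    · intro k hk
      by_contra hk'
      apply hk
      have : Function.extend e c (fun _ => (0, 0)) k = (0, 0) :=
        Function.extend_apply' _ _ _ (by simpa using hk')
      simp [this, hd]

/-- Volume comparison. -/
lemma pow_le_tsum {n : ℕ} (hn : 1 ≤ n) {d : ℝ} (hd : 0 < d) (hdn : d ≤ n)
    (c : ℕ → EuclideanSpace ℝ (Fin n) × ℝ≥0) (z : EuclideanSpace ℝ (Fin n)) {t : ℝ≥0}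
    (ht : 0 < t)
    (hcov : ball z (t : ℝ) ⊆ ⋃ j, ball (c j).1 (c j).2)
    (hsm : ∀ j, (ball (c j).1 (c j).2 ∩ ball z (t : ℝ)).Nonempty → (c j).2 < t) :
    (t : ℝ≥0∞) ^ d ≤ ∑' j, ((c j).2 : ℝ≥0∞) ^ d *
      (volume (ball (c j).1 ((c j).2 : ℝ) ∩ ball z (t : ℝ)) / volume (ball (c j).1 ((c j).2 : ℝ))) := by
  have : Nonempty (Fin n) := ⟨⟨0, hn⟩⟩
  have hvol : ∀ (x : EuclideanSpace ℝ (Fin n)) (r : ℝ≥0), volume (ball x (r : ℝ)) =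
      (r : ℝ≥0∞) ^ (n : ℝ) * volume (ball (0 : EuclideanSpace ℝ (Fin n)) 1) := by
    intro x r
    rw [Measure.addHaar_ball volume x (NNReal.coe_nonneg r), finrank_euclideanSpace, Fintype.card_fin,
      ENNReal.ofReal_pow (NNReal.coe_nonneg r)]
    simp
  have hv0 : volume (ball (0 : EuclideanSpace ℝ (Fin n)) 1) ≠ 0 :=
    (measure_ball_pos _ _ one_pos).ne'
  have hvt : volume (ball (0 : EuclideanSpace ℝ (Fin n)) 1) ≠ ∞ := measure_ball_lt_top.ne
  have hB0 : volume (ball z (t : ℝ)) ≠ 0 := (measure_ball_pos _ _ (by exact_mod_cast ht)).ne'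
  have hBt : volume (ball z (t : ℝ)) ≠ ∞ := measure_ball_lt_top.ne
  calc (t : ℝ≥0∞) ^ d = (t : ℝ≥0∞) ^ d * (volume (ball z (t : ℝ)) / volume (ball z (t : ℝ))) := by
        rw [ENNReal.div_self hB0 hBt, mul_one]
    _ ≤ (t : ℝ≥0∞) ^ d * ((∑' j, volume (ball (c j).1 ((c j).2 : ℝ) ∩ ball z (t : ℝ)))
          / volume (ball z (t : ℝ))) := by
        gcongr
        refine le_trans (measure_mono ?_) (measure_iUnion_le _)
        rw [← iUnion_inter]
        exact subset_inter hcov subset_rfl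
    _ = ∑' j, (t : ℝ≥0∞) ^ d * (volume (ball (c j).1 ((c j).2 : ℝ) ∩ ball z (t : ℝ))
          / volume (ball z (t : ℝ))) := by
        simp only [div_eq_mul_inv]
        rw [ENNReal.tsum_mul_left, ENNReal.tsum_mul_right]
    _ ≤ _ := by
        refine ENNReal.tsum_le_tsum fun j => ?_
        rcases (ball (c j).1 ((c j).2 : ℝ) ∩ ball z (t : ℝ)).eq_empty_or_nonempty with h | h
        · simp [h]
        have hlt := hsm j h
        have hr0 : 0 < (c j).2 := by
          obtain ⟨y, hy, -⟩ := h
          exact_mod_cast dist_nonneg.trans_lt (mem_ball.1 hy)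
        generalize volume (ball (c j).1 ((c j).2 : ℝ) ∩ ball z (t : ℝ)) = a
        rw [hvol, hvol]
        generalize (c j).2 = r at *
        generalize volume (ball (0 : EuclideanSpace ℝ (Fin n)) 1) = v at *
        have key : ∀ s : ℝ≥0, 0 < s → (s : ℝ≥0∞) ^ d * (a / ((s : ℝ≥0∞) ^ (n:ℝ) * v))
            = ((s : ℝ≥0∞) ^ ((n : ℝ) - d))⁻¹ * (a * v⁻¹) := by
          intro s hs
          have hs0 : (s : ℝ≥0∞) ≠ 0 := by exact_mod_cast hs.ne'
          rw [div_eq_mul_inv, ENNReal.mul_inv (Or.inr hvt) (Or.inr hv0), ← ENNReal.rpow_neg,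
            ← ENNReal.rpow_neg, neg_sub, sub_eq_add_neg, ENNReal.rpow_add _ _ hs0 ENNReal.coe_ne_top]
          ring
        rw [key t ht, key r hr0]
        gcongr

lemma Hcap_dilate {n : ℕ} (hn : 1 ≤ n) {d : ℝ} (hd : 0 < d) (hdn : d ≤ n) {β : ℝ} (hβ : 1 ≤ β)
    (T : Set (EuclideanSpace ℝ (Fin n) × ℝ≥0)) (hT : ∀ p ∈ T, 0 < p.2)
    (E F : Set (EuclideanSpace ℝ (Fin n))) (hE : ∀ p ∈ T, ball p.1 (p.2 : ℝ) ⊆ E)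
    (hF : ∀ x ∈ F, ∃ p ∈ T, dist x p.1 < (1 + β) * p.2) :
    Hcap n d F ≤ (2 * 7 ^ (n : ℝ)) * ENNReal.ofReal β ^ d * Hcap n d E := by
  have hβ0 : ENNReal.ofReal β ^ d ≠ 0 := by
    rw [ne_eq, ENNReal.rpow_eq_zero_iff]; simp; intro h; linarith
  have hKt : (2 * 7 ^ (n : ℝ)) * ENNReal.ofReal β ^ d ≠ ∞ := by
    refine ENNReal.mul_ne_top (ENNReal.mul_ne_top (by simp) ?_) ?_
    · exact ENNReal.rpow_ne_top_of_nonneg (by positivity) (by simp)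
    · exact ENNReal.rpow_ne_top_of_nonneg hd.le (by simp)
  have hK0 : (2 * 7 ^ (n : ℝ)) * ENNReal.ofReal β ^ d ≠ 0 := by
    refine mul_ne_zero (mul_ne_zero (by simp) ?_) hβ0
    simp
  conv_rhs => rw [Hcap]
  rw [ENNReal.mul_iInf_of_ne hK0 hKt]
  refine le_iInf fun c => ?_
  rw [ENNReal.mul_iInf_of_ne hK0 hKt]
  refine le_iInf fun hc => ?_
  by_cases hS : ∑' j, ((c j).2 : ℝ≥0∞) ^ d = ∞
  · rw [hS, ENNReal.mul_top hK0]; exact le_top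
  set S := ∑' j, ((c j).2 : ℝ≥0∞) ^ d with hSdef
  -- bad balls
  let bad : Set (EuclideanSpace ℝ (Fin n) × ℝ≥0) :=
    {p | p ∈ T ∧ ∀ j, (ball (c j).1 (c j).2 ∩ ball p.1 (p.2 : ℝ)).Nonempty → (c j).2 < p.2}
  have hbad : ∀ p ∈ bad, (p.2 : ℝ≥0∞) ^ d ≤ ∑' j, ((c j).2 : ℝ≥0∞) ^ d *
      (volume (ball (c j).1 ((c j).2 : ℝ) ∩ ball p.1 (p.2 : ℝ)) /
        volume (ball (c j).1 ((c j).2 : ℝ))) := fun p hp =>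
    pow_le_tsum hn hd hdn c p.1 (hT p hp.1) ((hE p hp.1).trans hc) hp.2
  have hbound : ∀ p ∈ bad, (p.2 : ℝ) ≤ (S ^ (1 / d)).toReal := by
    intro p hp
    have h1 : (p.2 : ℝ≥0∞) ^ d ≤ S := by
      refine (hbad p hp).trans (ENNReal.tsum_le_tsum fun j => ?_)
      refine mul_le_of_le_one_right' ?_
      exact ENNReal.div_le_of_le_mul (by rw [one_mul]; exact measure_mono inter_subset_left)
    have h2 : (p.2 : ℝ≥0∞) ≤ S ^ (1 / d) := by
      rw [one_div, ENNReal.le_rpow_inv_iff hd]; exact h1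
    have := ENNReal.toReal_mono (ENNReal.rpow_ne_top_of_nonneg (by positivity) hS) h2
    simpa using this
  have hne : ∀ p ∈ bad, (ball p.1 (p.2 : ℝ)).Nonempty := fun p hp =>
    nonempty_ball.2 (by exact_mod_cast hT p hp.1)
  obtain ⟨u, hut, hdisj, hcover⟩ := Vitali.exists_disjoint_subfamily_covering_enlargement
    (fun p : EuclideanSpace ℝ (Fin n) × ℝ≥0 => ball p.1 (p.2 : ℝ)) bad (fun p => (p.2 : ℝ)) 2
    one_lt_two (fun p _ => p.2.2) _ hbound hne
  have hucount : u.Countable := hdisj.countable_of_isOpen (fun _ _ => isOpen_ball)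
    (fun p hp => hne p (hut hp))
  have : Countable u := hucount.to_subtype
  have husum : ∑' p : u, ((p : EuclideanSpace ℝ (Fin n) × ℝ≥0).2 : ℝ≥0∞) ^ d ≤ S := by
    calc _ ≤ ∑' p : u, ∑' j, ((c j).2 : ℝ≥0∞) ^ d *
      (volume (ball (c j).1 ((c j).2 : ℝ) ∩ ball p.1.1 (p.1.2 : ℝ)) /
        volume (ball (c j).1 ((c j).2 : ℝ))) := ENNReal.tsum_le_tsum fun p => hbad p (hut p.2)
      _ = ∑' j, ((c j).2 : ℝ≥0∞) ^ d *
      ((∑' p : u, volume (ball (c j).1 ((c j).2 : ℝ) ∩ ball p.1.1 (p.1.2 : ℝ))) /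
        volume (ball (c j).1 ((c j).2 : ℝ))) := by
          rw [ENNReal.tsum_comm]
          simp only [div_eq_mul_inv, ENNReal.tsum_mul_left, ENNReal.tsum_mul_right]
      _ ≤ S := by
          refine ENNReal.tsum_le_tsum fun j => mul_le_of_le_one_right' ?_
          refine ENNReal.div_le_of_le_mul ?_
          rw [one_mul]
          refine (tsum_meas_le_meas_iUnion_of_disjoint volume
            (fun p => measurableSet_ball.inter measurableSet_ball) ?_).trans
            (measure_mono (iUnion_subset fun _ => inter_subset_left))
          intro p q hpq
          exact (hdisj p.2 q.2 (fun h => hpq (Subtype.ext h))).mono inter_subset_right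
            inter_subset_right
  let b : ℝ≥0 := 7 * β.toNNReal
  have hb : (b : ℝ) = 7 * β := by simp [b]; linarith
  have hbE : (b : ℝ≥0∞) ^ d ≤ 7 ^ (n : ℝ) * ENNReal.ofReal β ^ d := by
    have : (b : ℝ≥0∞) = 7 * ENNReal.ofReal β := by simp [b, ENNReal.ofReal]
    rw [this, ENNReal.mul_rpow_of_nonneg _ _ hd.le]
    gcongr
    norm_num
  let c' : ℕ ⊕ u → EuclideanSpace ℝ (Fin n) × ℝ≥0 :=
    Sum.elim (fun j => ((c j).1, b * (c j).2)) (fun p => (p.1.1, b * p.1.2))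
  have hcov' : F ⊆ ⋃ j, ball (c' j).1 (c' j).2 := by
    intro x hx
    obtain ⟨p, hp, hxp⟩ := hF x hx
    by_cases hpb : p ∈ bad
    · obtain ⟨q, hq, ⟨y, hyp, hyq⟩, hpq⟩ := hcover p hpb
      refine mem_iUnion.2 ⟨Sum.inr ⟨q, hq⟩, ?_⟩
      simp only [c', Sum.elim_inr, mem_ball, NNReal.coe_mul, hb] at hyp hyq ⊢
      have h1 := dist_triangle x p.1 q.1
      have h2 := dist_triangle_left p.1 q.1 y
      have h3 : 0 ≤ (q.2 : ℝ) := q.2.2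
      nlinarith
    · have : ∃ j, (ball (c j).1 (c j).2 ∩ ball p.1 (p.2 : ℝ)).Nonempty ∧ p.2 ≤ (c j).2 := by
        by_contra! h
        exact hpb ⟨hp, h⟩
      obtain ⟨j, ⟨y, hyj, hyp⟩, hj⟩ := this
      refine mem_iUnion.2 ⟨Sum.inl j, ?_⟩
      have hj' : (p.2 : ℝ) ≤ (c j).2 := by exact_mod_cast hj
      simp only [c', Sum.elim_inl, mem_ball, NNReal.coe_mul, hb] at hyp hyj ⊢
      have h1 := dist_triangle x p.1 (c j).1
      have h2 := dist_triangle_left p.1 (c j).1 y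
      have h3 : 0 ≤ (p.2 : ℝ) := p.2.2
      nlinarith
  refine (Hcap_le_of_countable hd c' hcov').trans ?_
  rw [Summable.tsum_sum ENNReal.summable ENNReal.summable]
  simp only [c', Sum.elim_inl, Sum.elim_inr, ENNReal.coe_mul, ENNReal.mul_rpow_of_nonneg _ _ hd.le,
    ENNReal.tsum_mul_left]
  calc _ ≤ (b : ℝ≥0∞) ^ d * S + (b : ℝ≥0∞) ^ d * S := by gcongr
    _ = 2 * (b : ℝ≥0∞) ^ d * S := by ring
    _ ≤ 2 * (7 ^ (n : ℝ) * ENNReal.ofReal β ^ d) * S := by gcongr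
    _ = _ := by ring

/-- `∫ N(ω_β) dH^d ≤ C β^d ∫ Nω dH^d` (Choquet integrals), with `C`
depending only on `n`. -/
theorem stmt3 (n : ℕ) (hn : 1 ≤ n) :
    ∃ C : ℝ≥0∞, 0 < C ∧ C ≠ ∞ ∧
      ∀ (d : ℝ), 0 < d → d ≤ (n : ℝ) →
      ∀ (β : ℝ), 1 ≤ β →
      ∀ ω : EuclideanSpace ℝ (Fin n) → ℝ → ℝ≥0∞, Measurable (Function.uncurry ω) →
        choquet n d (ntMax n (apDilate n β ω)) ≤
          C * ENNReal.ofReal β ^ d * choquet n d (ntMax n ω) := by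
  refine ⟨2 * 7 ^ (n : ℝ), by simp; positivity, ?_, ?_⟩
  · exact ENNReal.mul_ne_top (by simp) (ENNReal.rpow_ne_top_of_nonneg (by positivity) (by simp))
  intro d hd hdn β hβ ω _
  have hKt : (2 * 7 ^ (n : ℝ)) * ENNReal.ofReal β ^ d ≠ ∞ := by
    refine ENNReal.mul_ne_top (ENNReal.mul_ne_top (by simp) ?_) ?_
    · exact ENNReal.rpow_ne_top_of_nonneg (by positivity) (by simp)
    · exact ENNReal.rpow_ne_top_of_nonneg hd.le (by simp)
  unfold choquet
  rw [← lintegral_const_mul' _ _ hKt]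
  refine lintegral_mono fun lam => ?_
  refine Hcap_dilate hn hd hdn hβ {p | 0 < p.2 ∧ ENNReal.ofReal lam < ω p.1 p.2}
    (fun p hp => hp.1) _ _ ?_ ?_
  · intro p hp x hx
    simp only [mem_ofPred_eq, ntMax, lt_iSup_iff]
    exact ⟨p.1, p.2, by exact_mod_cast hp.1, by rw [dist_comm]; exact hx, hp.2⟩
  · intro x hx
    simp only [mem_ofPred_eq, ntMax, apDilate, lt_iSup_iff] at hx
    obtain ⟨y, t, ht, hyx, z, hzy, hz⟩ := hx
    refine ⟨(z, ⟨t, ht.le⟩), ⟨by exact_mod_cast ht, hz⟩, ?_⟩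
    show dist x z < (1 + β) * t
    have := dist_triangle_left x z y
    rw [dist_comm z y] at hzy
    linarith

end
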